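/- Let β < 0, let α ∈ ℝ, let V : ℝ → ℝ be the quartic potential V(q) = q²/2 + (α/3)q³ + (β/4)q⁴, set q₊ = (−α + √(α²−4β))/(2β), q₋ = (−α − √(α²−4β))/(2β) and E_max = min{V(q₊), V(q₋)}. Then for every E with 0 < E < E_max there exist real numbers a > b > c > d such that E − V(q) = −(β/4)·(q − a)·(q − b)·(q − c)·(q − d) for all q ∈ ℝ, and moreover d < q₊ < c < 0 < b < q₋ < a. -/

import Mathlib

theorem cubic_zero_aux (p0 p1 p2 p3 a b c d : ℝ) (hab : b < a) (hbc : c < b) (hcd : d < c)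
    (ha : p3 * a ^ 3 + p2 * a ^ 2 + p1 * a + p0 = 0)
    (hb : p3 * b ^ 3 + p2 * b ^ 2 + p1 * b + p0 = 0)
    (hc : p3 * c ^ 3 + p2 * c ^ 2 + p1 * c + p0 = 0)
    (hd : p3 * d ^ 3 + p2 * d ^ 2 + p1 * d + p0 = 0) (q : ℝ) :
    p3 * q ^ 3 + p2 * q ^ 2 + p1 * q + p0 = 0 := by
  have n1 : a - b ≠ 0 := by intro h; linarith
  have n2 : a - c ≠ 0 := by intro h; linarith
  have n3 : a - d ≠ 0 := by intro h; linarith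
  have n4 : b - c ≠ 0 := by intro h; linarith
  have n5 : b - d ≠ 0 := by intro h; linarith
  have n6 : c - d ≠ 0 := by intro h; linarith
  have e1 : p3 * (a ^ 2 + a * b + b ^ 2) + p2 * (a + b) + p1 = 0 := by
    apply mul_left_cancel₀ n1; linear_combination ha - hb
  have e2 : p3 * (a ^ 2 + a * c + c ^ 2) + p2 * (a + c) + p1 = 0 := by
    apply mul_left_cancel₀ n2; linear_combination ha - hc
  have e3 : p3 * (a ^ 2 + a * d + d ^ 2) + p2 * (a + d) + p1 = 0 := by
    apply mul_left_cancel₀ n3; linear_combination ha - hd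
  have f1 : p3 * (a + b + c) + p2 = 0 := by
    apply mul_left_cancel₀ n4; linear_combination e1 - e2
  have f2 : p3 * (a + b + d) + p2 = 0 := by
    apply mul_left_cancel₀ n5; linear_combination e1 - e3
  have g : p3 = 0 := by
    apply mul_left_cancel₀ n6; linear_combination f1 - f2
  subst g
  have h2 : p2 = 0 := by linarith
  subst h2
  have h1 : p1 = 0 := by linarith
  subst h1
  linarith

theorem tail_aux (α β q : ℝ) (hβ : β < 0) (hq1 : 1 ≤ |q|) (hq : 4 * (|α| + 1) / (-β) ≤ |q|) :
    q ^ 2 / 2 + α / 3 * q ^ 3 + β / 4 * q ^ 4 ≤ 0 := by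
  rw [div_le_iff₀ (by linarith)] at hq
  have h1 : α * q ≤ |α| * |q| := by rw [← abs_mul]; exact le_abs_self _
  have h2 : |q| ^ 2 = q ^ 2 := sq_abs q
  have h0 := abs_nonneg α
  have h4 : 0 ≤ |α| * |q| := by positivity
  have h3 : 1 / 2 + α / 3 * q + β / 4 * q ^ 2 ≤ 0 := by
    rw [← h2]
    nlinarith [mul_le_mul_of_nonneg_right hq (abs_nonneg q)]
  nlinarith [mul_nonneg (sq_nonneg q) (neg_nonneg.mpr h3)]


/-- Case II (inverted quartic potential, `β < 0`): for every energy
`0 < E < E_max`, the quartic `E − V(q)` has four real roots `a > b > c > d`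
interlacing with the critical points as `d < q₊ < c < 0 < b < q₋ < a`. -/
theorem invertedQuartic_four_real_roots (α β : ℝ) (hβ : β < 0)
    (V : ℝ → ℝ) (hV : ∀ q : ℝ, V q = q ^ 2 / 2 + α / 3 * q ^ 3 + β / 4 * q ^ 4)
    (qplus qminus Emax : ℝ)
    (hqp : qplus = (-α + Real.sqrt (α ^ 2 - 4 * β)) / (2 * β))
    (hqm : qminus = (-α - Real.sqrt (α ^ 2 - 4 * β)) / (2 * β))
    (hEmax : Emax = min (V qplus) (V qminus)) :
    ∀ E : ℝ, 0 < E → E < Emax →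
      ∃ a b c d : ℝ, b < a ∧ c < b ∧ d < c ∧
        (∀ q : ℝ, E - V q = -(β / 4) * (q - a) * (q - b) * (q - c) * (q - d)) ∧
        d < qplus ∧ qplus < c ∧ c < 0 ∧ 0 < b ∧ b < qminus ∧ qminus < a := by
  intro E hE hEm
  rw [hEmax, lt_min_iff] at hEm
  obtain ⟨hEp, hEq⟩ := hEm
  have hs : |α| < Real.sqrt (α ^ 2 - 4 * β) := by
    apply Real.lt_sqrt_of_sq_lt
    rw [sq_abs]; linarith
  have hs1 := le_abs_self α
  have hs2 := neg_abs_le α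
  have hp0 : qplus < 0 := by
    rw [hqp]; exact div_neg_of_pos_of_neg (by linarith) (by linarith)
  have hm0 : 0 < qminus := by
    rw [hqm]; exact div_pos_of_neg_of_neg (by linarith) (by linarith)
  have hcont : Continuous V := by
    have : V = fun q => q ^ 2 / 2 + α / 3 * q ^ 3 + β / 4 * q ^ 4 := funext hV
    rw [this]; fun_prop
  have hV0 : V 0 = 0 := by rw [hV]; ring
  obtain ⟨M, hM⟩ : ∃ M : ℝ, M = 4 * (|α| + 1) / (-β) + 1 - qplus + qminus := ⟨_, rfl⟩
  have hK : 0 ≤ 4 * (|α| + 1) / (-β) :=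
    div_nonneg (by linarith [abs_nonneg α]) (by linarith)
  have hMpos : 0 < M := by linarith
  have habs : |M| = M := abs_of_pos hMpos
  have hVM : V M ≤ 0 := by
    rw [hV]; apply tail_aux _ _ _ hβ <;> rw [habs] <;> linarith
  have hVM' : V (-M) ≤ 0 := by
    rw [hV]; apply tail_aux _ _ _ hβ <;> rw [abs_neg, habs] <;> linarith
  obtain ⟨d, ⟨-, hd⟩, hVd⟩ := intermediate_value_Ioo (show -M ≤ qplus by linarith)
    hcont.continuousOn (show E ∈ Set.Ioo (V (-M)) (V qplus) from ⟨by linarith, hEp⟩)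
  obtain ⟨c, ⟨hc1, hc2⟩, hVc⟩ := intermediate_value_Ioo' hp0.le
    hcont.continuousOn (show E ∈ Set.Ioo (V 0) (V qplus) from ⟨by linarith, hEp⟩)
  obtain ⟨b, ⟨hb1, hb2⟩, hVb⟩ := intermediate_value_Ioo hm0.le
    hcont.continuousOn (show E ∈ Set.Ioo (V 0) (V qminus) from ⟨by linarith, hEq⟩)
  obtain ⟨a, ⟨ha, -⟩, hVa⟩ := intermediate_value_Ioo' (show qminus ≤ M by linarith)
    hcont.continuousOn (show E ∈ Set.Ioo (V M) (V qminus) from ⟨by linarith, hEq⟩)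
  refine ⟨a, b, c, d, by linarith, by linarith, by linarith, ?_, hd, hc1, hc2, hb1, hb2, ha⟩
  intro q
  rw [hV] at hVa hVb hVc hVd
  have key := cubic_zero_aux
    (E + β / 4 * (a * b * c * d))
    (-(β / 4) * (a * b * c + a * b * d + a * c * d + b * c * d))
    (-1 / 2 + β / 4 * (a * b + a * c + a * d + b * c + b * d + c * d))
    (-α / 3 - β / 4 * (a + b + c + d))
    a b c d (by linarith) (by linarith) (by linarith)
    (by linear_combination -hVa) (by linear_combination -hVb)
    (by linear_combination -hVc) (by linear_combination -hVd) q
  rw [hV]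
  linear_combination key
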